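/- If X is a Tychonoff space such that C_p(X) is separable and C_p(X) satisfies F_fin(𝒮, Ω_0), then C_p(X) satisfies F_fin(𝒮, 𝒟). -/

import Mathlib

open Set Filter Topology

universe u

/-- A zero-set: the preimage of `{0}` under some continuous real-valued function. -/
def IsZeroSet {X : Type u} [TopologicalSpace X] (Z : Set X) : Prop :=
  ∃ f : X → ℝ, Continuous f ∧ Z = f ⁻¹' {0}

/-- A cozero-set: the complement of a zero-set. -/
def IsCozeroSet {X : Type u} [TopologicalSpace X] (U : Set X) : Prop :=
  IsZeroSet Uᶜ

/-- A γ-cover (no openness requirement): an infinite nontrivial cover such that every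
point belongs to all but finitely many members. -/
def IsGammaCoverSets {X : Type u} (𝒰 : Set (Set X)) : Prop :=
  (univ : Set X) ∉ 𝒰 ∧ 𝒰.Infinite ∧ ⋃₀ 𝒰 = (univ : Set X) ∧
    ∀ x : X, {U ∈ 𝒰 | x ∉ U}.Finite

/-- An open γ-cover. -/
def IsOpenGammaCover {X : Type u} [TopologicalSpace X] (𝒰 : Set (Set X)) : Prop :=
  (∀ U ∈ 𝒰, IsOpen U) ∧ IsGammaCoverSets 𝒰

/-- A γ_F-shrinkable γ-cover: a γ-cover of cozero-sets admitting a shrinking by zero-sets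
which is again a γ-cover. -/
def IsGammaFCover {X : Type u} [TopologicalSpace X] (𝒰 : Set (Set X)) : Prop :=
  IsOpenGammaCover 𝒰 ∧ (∀ U ∈ 𝒰, IsCozeroSet U) ∧
    ∃ F : Set X → Set X, (∀ U ∈ 𝒰, IsZeroSet (F U) ∧ F U ⊆ U) ∧
      IsGammaCoverSets (F '' 𝒰)

/-- An ω-cover: a nontrivial open cover such that every finite subset of the space is
contained in some member. -/
def IsOmegaCover {X : Type u} [TopologicalSpace X] (𝒰 : Set (Set X)) : Prop :=
  (∀ U ∈ 𝒰, IsOpen U) ∧ (univ : Set X) ∉ 𝒰 ∧ ⋃₀ 𝒰 = (univ : Set X) ∧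
    ∀ K : Set X, K.Finite → ∃ U ∈ 𝒰, K ⊆ U

/-- The family contains a finite subcover. -/
def HasFinSubcover {X : Type u} (𝒰 : Set (Set X)) : Prop :=
  ∃ 𝓕 ⊆ 𝒰, 𝓕.Finite ∧ ⋃₀ 𝓕 = (univ : Set X)

/-- `U_fin(Γ_F, Ω)`. -/
def UfinGammaFOmega (X : Type u) [TopologicalSpace X] : Prop :=
  ∀ 𝒰 : ℕ → Set (Set X), (∀ n, IsGammaFCover (𝒰 n)) →
    (∀ n, ¬ HasFinSubcover (𝒰 n)) →
    ∃ 𝓕 : ℕ → Set (Set X), (∀ n, 𝓕 n ⊆ 𝒰 n ∧ (𝓕 n).Finite) ∧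
      IsOmegaCover (Set.range fun n => ⋃₀ 𝓕 n)

/-- `U_fin(Γ_F, Γ)`. -/
def UfinGammaFGamma (X : Type u) [TopologicalSpace X] : Prop :=
  ∀ 𝒰 : ℕ → Set (Set X), (∀ n, IsGammaFCover (𝒰 n)) →
    (∀ n, ¬ HasFinSubcover (𝒰 n)) →
    ∃ 𝓕 : ℕ → Set (Set X), (∀ n, 𝓕 n ⊆ 𝒰 n ∧ (𝓕 n).Finite) ∧
      IsOpenGammaCover (Set.range fun n => ⋃₀ 𝓕 n)

/-- `U_fin(𝒪, Ω)`. -/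
def UfinOOmega (X : Type u) [TopologicalSpace X] : Prop :=
  ∀ 𝒰 : ℕ → Set (Set X),
    (∀ n, (∀ U ∈ 𝒰 n, IsOpen U) ∧ ⋃₀ 𝒰 n = (univ : Set X)) →
    (∀ n, ¬ HasFinSubcover (𝒰 n)) →
    ∃ 𝓕 : ℕ → Set (Set X), (∀ n, 𝓕 n ⊆ 𝒰 n ∧ (𝓕 n).Finite) ∧
      IsOmegaCover (Set.range fun n => ⋃₀ 𝓕 n)

/-- The Hurewicz property `U_fin(𝒪, Γ)`. -/
def HurewiczProperty (X : Type u) [TopologicalSpace X] : Prop :=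
  ∀ 𝒰 : ℕ → Set (Set X),
    (∀ n, (∀ U ∈ 𝒰 n, IsOpen U) ∧ ⋃₀ 𝒰 n = (univ : Set X)) →
    ∃ 𝓕 : ℕ → Set (Set X), (∀ n, 𝓕 n ⊆ 𝒰 n ∧ (𝓕 n).Finite) ∧
      ∀ x : X, {n : ℕ | x ∉ ⋃₀ 𝓕 n}.Finite

/- Function space notions.  `C_p(X)` is the set of continuous functions `X → ℝ` with
the topology of pointwise convergence, i.e. the topology inherited from the product
topology on `X → ℝ` (the default `Pi` topology instance). -/

/-- A sequentially dense subset of `C_p(X)`: every continuous function is the pointwise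
limit of a sequence from `D`. -/
def SeqDenseCp {X : Type u} [TopologicalSpace X] (D : Set (X → ℝ)) : Prop :=
  (∀ f ∈ D, Continuous f) ∧ ∀ f : X → ℝ, Continuous f →
    ∃ g : ℕ → X → ℝ, (∀ n, g n ∈ D) ∧ Tendsto g atTop (𝓝 f)

/-- A dense subset of `C_p(X)`: every neighborhood (in the topology of pointwise
convergence) of every continuous function meets `D`. -/
def DenseCp {X : Type u} [TopologicalSpace X] (D : Set (X → ℝ)) : Prop :=
  (∀ f ∈ D, Continuous f) ∧ ∀ f : X → ℝ, Continuous f →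
    ∀ U ∈ 𝓝 f, (U ∩ D).Nonempty

/-- `C_p(X)` is separable. -/
def CpSeparable (X : Type u) [TopologicalSpace X] : Prop :=
  ∃ D : Set (X → ℝ), D.Countable ∧ DenseCp D

/-- `C_p(X)` is sequentially separable. -/
def CpSeqSeparable (X : Type u) [TopologicalSpace X] : Prop :=
  ∃ D : Set (X → ℝ), D.Countable ∧ SeqDenseCp D

/-- `A ∈ Γ_0`: a countable set of continuous functions, not containing `0`, infinite,
converging to `0` (every neighborhood of `0` in the topology of pointwise convergence
contains all but finitely many elements of `A`). -/
def GammaZero {X : Type u} [TopologicalSpace X] (A : Set (X → ℝ)) : Prop :=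
  A.Countable ∧ (∀ f ∈ A, Continuous f) ∧ (0 : X → ℝ) ∉ A ∧ A.Infinite ∧
    ∀ U ∈ 𝓝 (0 : X → ℝ), (A \ U).Finite

/-- `C_p(X)` satisfies `F_fin(𝒮, 𝒟)`. -/
def FfinSD (X : Type u) [TopologicalSpace X] : Prop :=
  ∀ S : ℕ → Set (X → ℝ), (∀ n, SeqDenseCp (S n)) →
    ∃ F : ℕ → Set (X → ℝ), (∀ n, F n ⊆ S n ∧ (F n).Finite) ∧
      ∀ f : X → ℝ, Continuous f → ∀ ε : ℝ, 0 < ε → ∀ K : Set X, K.Finite →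
        ∃ n : ℕ, ∀ x ∈ K, ∃ h ∈ F n, |f x - h x| < ε

/-- `C_p(X)` satisfies `F_fin(Γ_0, Ω_0)`. -/
def FfinGammaOmega (X : Type u) [TopologicalSpace X] : Prop :=
  ∀ S : ℕ → Set (X → ℝ), (∀ n, GammaZero (S n)) →
    ∃ F : ℕ → Set (X → ℝ), (∀ n, F n ⊆ S n ∧ (F n).Finite) ∧
      ∀ ε : ℝ, 0 < ε → ∀ K : Set X, K.Finite →
        ∃ n : ℕ, ∀ x ∈ K, ∃ h ∈ F n, |h x| < ε

/-- `C_p(X)` satisfies `F_fin(𝒮, Ω_0)`. -/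
def FfinSOmega (X : Type u) [TopologicalSpace X] : Prop :=
  ∀ S : ℕ → Set (X → ℝ), (∀ n, SeqDenseCp (S n)) →
    ∃ F : ℕ → Set (X → ℝ), (∀ n, F n ⊆ S n ∧ (F n).Finite) ∧
      ∀ ε : ℝ, 0 < ε → ∀ K : Set X, K.Finite →
        ∃ n : ℕ, ∀ x ∈ K, ∃ h ∈ F n, |h x| < ε

/-- `C_p(X)` satisfies `F_fin(𝒮, 𝒮)`. -/
def FfinSS (X : Type u) [TopologicalSpace X] : Prop :=
  ∀ S : ℕ → Set (X → ℝ), (∀ n, SeqDenseCp (S n)) →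
    ∃ F : ℕ → Set (X → ℝ), (∀ n, F n ⊆ S n ∧ (F n).Finite) ∧
      ∀ f : X → ℝ, Continuous f → ∀ ε : ℝ, 0 < ε → ∀ K : Set X, K.Finite →
        ∃ n' : ℕ, ∀ n : ℕ, n' < n → ∀ x ∈ K, ∃ h ∈ F n, |f x - h x| < ε

/-- `C_p(X)` satisfies `F_fin(Γ_0, Γ_0)`. -/
def FfinGammaGamma (X : Type u) [TopologicalSpace X] : Prop :=
  ∀ S : ℕ → Set (X → ℝ), (∀ n, GammaZero (S n)) →
    ∃ F : ℕ → Set (X → ℝ), (∀ n, F n ⊆ S n ∧ (F n).Finite) ∧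
      ∀ ε : ℝ, 0 < ε → ∀ K : Set X, K.Finite →
        ∃ n' : ℕ, ∀ n : ℕ, n' < n → ∀ x ∈ K, ∃ h ∈ F n, |h x| < ε

/-- `C_p(X)` satisfies `F_fin(𝒮, Γ_0)`. -/
def FfinSGamma (X : Type u) [TopologicalSpace X] : Prop :=
  ∀ S : ℕ → Set (X → ℝ), (∀ n, SeqDenseCp (S n)) →
    ∃ F : ℕ → Set (X → ℝ), (∀ n, F n ⊆ S n ∧ (F n).Finite) ∧
      ∀ ε : ℝ, 0 < ε → ∀ K : Set X, K.Finite →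
        ∃ n' : ℕ, ∀ n : ℕ, n' < n → ∀ x ∈ K, ∃ h ∈ F n, |h x| < ε

/-- `iw(X) = ℵ₀`: there is a continuous bijection from `X` onto a second-countable
Tychonoff space. -/
def IWCountable (X : Type u) [TopologicalSpace X] : Prop :=
  ∃ (Y : Type u) (tY : TopologicalSpace Y),
    @SecondCountableTopology Y tY ∧ @CompletelyRegularSpace Y tY ∧ @T2Space Y tY ∧
    ∃ f : X → Y, @Continuous X Y _ tY f ∧ Function.Bijective f

/-- The Velichko property `X ⊨ V`: there is a continuous bijection onto a separable
metrizable space sending every cozero-set to an `F_σ`-set. -/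
def VelichkoProperty (X : Type u) [TopologicalSpace X] : Prop :=
  ∃ (Y : Type u) (tY : TopologicalSpace Y),
    @TopologicalSpace.MetrizableSpace Y tY ∧ @TopologicalSpace.SeparableSpace Y tY ∧
    ∃ f : X → Y, @Continuous X Y _ tY f ∧ Function.Bijective f ∧
      ∀ U : Set X, IsCozeroSet U →
        ∃ Z : ℕ → Set Y, (∀ n, @IsClosed Y tY (Z n)) ∧ f '' U = ⋃ n, Z n

/-- Sequential density in `C_p(X)` is invariant under translation by a continuous function. -/
theorem SeqDenseCp.preimage_add_right {X : Type u} [TopologicalSpace X] {D : Set (X → ℝ)}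
    (hD : SeqDenseCp D) {d : X → ℝ} (hd : Continuous d) :
    SeqDenseCp ((fun f => f + d) ⁻¹' D) := by
  refine ⟨fun f hf => ?_, fun f hf => ?_⟩
  · have hfd : Continuous (f + d) := hD.1 _ hf
    simpa using hfd.sub hd
  · obtain ⟨g, hgD, hg⟩ := hD.2 (f + d) (hf.add hd)
    refine ⟨fun n => g n - d, fun n => by simpa using hgD n, ?_⟩
    simpa using hg.sub_const d

/-- A dense subset of `C_p(X)` approximates every continuous function on finite sets. -/
theorem DenseCp.exists_abs_sub_lt {X : Type u} [TopologicalSpace X] {D : Set (X → ℝ)}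
    (hD : DenseCp D) {f : X → ℝ} (hf : Continuous f) {ε : ℝ} (hε : 0 < ε) {K : Set X}
    (hK : K.Finite) : ∃ d ∈ D, ∀ x ∈ K, |f x - d x| < ε := by
  obtain ⟨d, hd, hdD⟩ := hD.2 f hf (K.pi fun x => Metric.ball (f x) ε)
    (set_pi_mem_nhds hK fun x _ => Metric.ball_mem_nhds _ hε)
  refine ⟨d, hdD, fun x hx => ?_⟩
  have hdx : dist (d x) (f x) < ε := hd x hx
  rwa [dist_comm, Real.dist_eq] at hdx

/-- (Theorem 3.3, (4) ⇒ (1)): if `C_p(X)` is separable and satisfies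
`F_fin(𝒮, Ω_0)`, then `C_p(X)` satisfies `F_fin(𝒮, 𝒟)`. -/
theorem stmt15 (X : Type u) [TopologicalSpace X] [CompletelyRegularSpace X] [T2Space X]
    (hsep : CpSeparable X) (h : FfinSOmega X) : FfinSD X := by
  obtain ⟨D, hDc, hD⟩ := hsep
  have hne : D.Nonempty := (hD.2 0 continuous_const univ univ_mem).mono inter_subset_right
  obtain ⟨d, rfl⟩ := hDc.exists_eq_range hne
  intro S hS
  have hd : ∀ k, Continuous (d k) := fun k => hD.1 _ (mem_range_self k)
  choose F hF hFK using fun k => h (fun m => (fun f => f + d k) ⁻¹' S (Nat.pair k m))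
    fun m => (hS _).preimage_add_right (hd k)
  refine ⟨fun n => (fun f => f + d n.unpair.1) '' F n.unpair.1 n.unpair.2,
    fun n => ⟨?_, (hF _ _).2.image _⟩, fun f hf ε hε K hK => ?_⟩
  · rintro _ ⟨g, hg, rfl⟩
    simpa using (hF _ _).1 hg
  · obtain ⟨_, ⟨k, rfl⟩, hk⟩ := hD.exists_abs_sub_lt hf (half_pos hε) hK
    obtain ⟨m, hm⟩ := hFK k (ε / 2) (half_pos hε) K hK
    refine ⟨Nat.pair k m, fun x hx => ?_⟩
    obtain ⟨g, hg, hgx⟩ := hm x hx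
    refine ⟨g + d k, ⟨g, by simpa using hg, by simp⟩, ?_⟩
    calc |f x - (g + d k) x| = |(f x - d k x) - g x| := by rw [Pi.add_apply]; ring_nf
      _ ≤ |f x - d k x| + |g x| := abs_sub _ _
      _ < ε := by linarith [hk x hx]
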